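/- Let N ≥ 1 and let f, g, h : ℝ → ℝ be N-times differentiable functions satisfying det [[1,1,1],[f(x),g(y),h(z)],[f'(x),g'(y),h'(z)]] = 0 for all real x, y, z with x + y + z = 0. With aₖ(x,y) = g⁽ᵏ⁻¹⁾(y) + (−1)ᵏ f⁽ᵏ⁻¹⁾(x), bₖ(x,y) = g⁽ᵏ⁾(y) + (−1)ᵏ f⁽ᵏ⁾(x), cₖ(x,y) = Σ_{j=0}^{k} C(k,j) (−1)ʲ f⁽ʲ⁾(x) g⁽ᵏ⁻ʲ⁾(y), the following hold for all 1 ≤ k, l ≤ N, all real x, y, and z = −x − y: (aₖbₗ − aₗbₖ)·h(z) = aₖcₗ − aₗcₖ, and (aₖbₗ − aₗbₖ)·h'(z) = bₖcₗ − bₗcₖ. -/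

import Mathlib

/-- `aₖ(x,y) = g⁽ᵏ⁻¹⁾(y) + (−1)ᵏ f⁽ᵏ⁻¹⁾(x)`, i.e. `∂^(k-1)(g(y) − f(x))`
with `∂ = ∂_y − ∂_x`. -/
noncomputable def aFun (f g : ℝ → ℝ) (k : ℕ) (x y : ℝ) : ℝ :=
  iteratedDeriv (k - 1) g y + (-1 : ℝ) ^ k * iteratedDeriv (k - 1) f x

/-- `bₖ(x,y) = g⁽ᵏ⁾(y) + (−1)ᵏ f⁽ᵏ⁾(x)`, i.e. `∂^k(g(y) + f(x))`. -/
noncomputable def bFun (f g : ℝ → ℝ) (k : ℕ) (x y : ℝ) : ℝ :=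
  iteratedDeriv k g y + (-1 : ℝ) ^ k * iteratedDeriv k f x

/-- `cₖ(x,y) = Σ_{j=0}^{k} C(k,j) (−1)ʲ f⁽ʲ⁾(x) g⁽ᵏ⁻ʲ⁾(y)`, i.e. `∂^k(g(y)·f(x))`. -/
noncomputable def cFun (f g : ℝ → ℝ) (k : ℕ) (x y : ℝ) : ℝ :=
  ∑ j ∈ Finset.range (k + 1),
    (k.choose j : ℝ) * (-1 : ℝ) ^ j * iteratedDeriv j f x * iteratedDeriv (k - j) g y

theorem hasDerivAt_comp_const_sub {φ : ℝ → ℝ} (x : ℝ) (hφ : Differentiable ℝ φ) :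
    HasDerivAt (fun t => φ (x - t)) (-deriv φ x) 0 := by
  have h : HasDerivAt φ (deriv φ x) (x - 0) := by
    simpa using (hφ x).hasDerivAt
  exact h.comp_const_sub x 0

theorem hasDerivAt_comp_const_add {φ : ℝ → ℝ} (y : ℝ) (hφ : Differentiable ℝ φ) :
    HasDerivAt (fun t => φ (y + t)) (deriv φ y) 0 := by
  have h : HasDerivAt φ (deriv φ y) (y + 0) := by
    simpa using (hφ y).hasDerivAt
  exact h.comp_const_add y 0

theorem hasDerivAt_iteratedDeriv_add {f g : ℝ → ℝ} {k : ℕ} (c x y : ℝ)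
    (hf : Differentiable ℝ (iteratedDeriv k f)) (hg : Differentiable ℝ (iteratedDeriv k g)) :
    HasDerivAt (fun t => iteratedDeriv k g (y + t) + c * iteratedDeriv k f (x - t))
      (iteratedDeriv (k + 1) g y + -c * iteratedDeriv (k + 1) f x) 0 := by
  rw [iteratedDeriv_succ, iteratedDeriv_succ]
  refine ((hasDerivAt_comp_const_add y hg).add
    ((hasDerivAt_comp_const_sub x hf).const_mul c)).congr_deriv ?_
  ring

theorem hasDerivAt_aFun {f g : ℝ → ℝ} {k : ℕ} (hk : 1 ≤ k) (x y : ℝ)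
    (hf : Differentiable ℝ (iteratedDeriv (k - 1) f))
    (hg : Differentiable ℝ (iteratedDeriv (k - 1) g)) :
    HasDerivAt (fun t => aFun f g k (x - t) (y + t)) (aFun f g (k + 1) x y) 0 := by
  refine (hasDerivAt_iteratedDeriv_add ((-1) ^ k) x y hf hg).congr_deriv ?_
  simp [aFun, pow_succ, Nat.sub_add_cancel hk]

theorem hasDerivAt_bFun {f g : ℝ → ℝ} {k : ℕ} (x y : ℝ)
    (hf : Differentiable ℝ (iteratedDeriv k f)) (hg : Differentiable ℝ (iteratedDeriv k g)) :
    HasDerivAt (fun t => bFun f g k (x - t) (y + t)) (bFun f g (k + 1) x y) 0 := by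
  refine (hasDerivAt_iteratedDeriv_add ((-1) ^ k) x y hf hg).congr_deriv ?_
  simp [bFun, pow_succ]

theorem hasDerivAt_cFun {f g : ℝ → ℝ} {k : ℕ} (x y : ℝ)
    (hf : ∀ i ≤ k, Differentiable ℝ (iteratedDeriv i f))
    (hg : ∀ i ≤ k, Differentiable ℝ (iteratedDeriv i g)) :
    HasDerivAt (fun t => cFun f g k (x - t) (y + t)) (cFun f g (k + 1) x y) 0 := by
  have key : ∀ j ∈ Finset.range (k + 1), HasDerivAt
      (fun t => (k.choose j : ℝ) * (-1 : ℝ) ^ j * iteratedDeriv j f (x - t) *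
        iteratedDeriv (k - j) g (y + t))
      ((k.choose j : ℝ) * ((-1) ^ j * iteratedDeriv j f x * iteratedDeriv (k + 1 - j) g y) +
        (k.choose j : ℝ) *
          ((-1) ^ (j + 1) * iteratedDeriv (j + 1) f x * iteratedDeriv (k - j) g y)) 0 := by
    intro j hj
    have hjk : j ≤ k := Finset.mem_range_succ_iff.mp hj
    refine (((hasDerivAt_comp_const_sub x (hf j hjk)).const_mul _).mul
      (hasDerivAt_comp_const_add y (hg (k - j) (k.sub_le j)))).congr_deriv ?_
    rw [Nat.succ_sub hjk, iteratedDeriv_succ, iteratedDeriv_succ, sub_zero, add_zero]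
    ring
  refine (HasDerivAt.fun_sum key).congr_deriv ?_
  rw [Finset.sum_add_distrib, ← Finset.sum_choose_succ_mul
    (fun i j => (-1 : ℝ) ^ i * iteratedDeriv i f x * iteratedDeriv j g y)]
  simp only [cFun, mul_assoc]

/-- Differentiating the determinant equation along `∂_y - ∂_x`, with `z = -x - y` fixed. -/
theorem aFun_mul_deriv_sub_bFun_mul_add_cFun {N : ℕ} {f g h : ℝ → ℝ}
    (hf : ∀ i < N, Differentiable ℝ (iteratedDeriv i f))
    (hg : ∀ i < N, Differentiable ℝ (iteratedDeriv i g))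
    (heq : ∀ x y z : ℝ, x + y + z = 0 →
      Matrix.det !![(1 : ℝ), 1, 1; f x, g y, h z; deriv f x, deriv g y, deriv h z] = 0)
    {k : ℕ} (hk : 1 ≤ k) (hkN : k ≤ N) (x y : ℝ) :
    aFun f g k x y * deriv h (-x - y) - bFun f g k x y * h (-x - y) + cFun f g k x y = 0 := by
  induction k, hk using Nat.le_induction generalizing x y with
  | base =>
    have h0 := heq x y (-x - y) (by ring)
    rw [Matrix.det_fin_three] at h0
    simp at h0
    simp [aFun, bFun, cFun, Finset.sum_range_succ]
    linear_combination h0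
  | succ k hk ih =>
    have hd := (((hasDerivAt_aFun hk x y (hf _ (by omega)) (hg _ (by omega))).mul_const
      (deriv h (-x - y))).sub ((hasDerivAt_bFun x y (hf k hkN) (hg k hkN)).mul_const
      (h (-x - y)))).add (hasDerivAt_cFun (k := k) x y (fun i hi => hf i (by omega))
      (fun i hi => hg i (by omega)))
    refine hd.unique ((hasDerivAt_const (0 : ℝ) (0 : ℝ)).congr_of_eventuallyEq
      (Filter.Eventually.of_forall fun t => ?_))
    have ht := ih (by omega) (x - t) (y + t)
    rwa [show -(x - t) - (y + t) = -x - y by ring] at ht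

theorem stmt_9 (N : ℕ) (hN : 1 ≤ N) (f g h : ℝ → ℝ)
    (hf : ∀ i < N, Differentiable ℝ (iteratedDeriv i f))
    (hg : ∀ i < N, Differentiable ℝ (iteratedDeriv i g))
    (hh : ∀ i < N, Differentiable ℝ (iteratedDeriv i h))
    (heq : ∀ x y z : ℝ, x + y + z = 0 →
      Matrix.det !![(1 : ℝ), 1, 1; f x, g y, h z; deriv f x, deriv g y, deriv h z] = 0) :
    ∀ k l : ℕ, 1 ≤ k → k ≤ N → 1 ≤ l → l ≤ N → ∀ x y : ℝ,
      ((aFun f g k x y * bFun f g l x y - aFun f g l x y * bFun f g k x y) * h (-x - y)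
        = aFun f g k x y * cFun f g l x y - aFun f g l x y * cFun f g k x y) ∧
      ((aFun f g k x y * bFun f g l x y - aFun f g l x y * bFun f g k x y) * deriv h (-x - y)
        = bFun f g k x y * cFun f g l x y - bFun f g l x y * cFun f g k x y) := by
  intro k l hk hkN hl hlN x y
  have hk' := aFun_mul_deriv_sub_bFun_mul_add_cFun hf hg heq hk hkN x y
  have hl' := aFun_mul_deriv_sub_bFun_mul_add_cFun hf hg heq hl hlN x y
  constructor
  · linear_combination aFun f g l x y * hk' - aFun f g k x y * hl'
  · linear_combination bFun f g l x y * hk' - bFun f g k x y * hl'
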